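/- With the asymptotically Schwarzschild change of coordinates x̃⁰=t, x̃^i=x^i+Mω^iχ(r/(t+1))ln r, Jacobian A^a_α=∂x̃^a/∂x^α and inverse A^α_a (with 0<M≤M₀ for a sufficiently small absolute constant M₀): for every multiindex I there is a constant C_I, independent of M, t, x, such that for all t≥0, x≠0: |Z^I(A^a_α−δ^a_α)| + |Z^I(A^α_a−δ^α_a)| ≤ C_I M ⟨ln r⟩ r^{−1}, where Z^I is any product of |I| Minkowski commuting vector fields; and these quantities vanish identically on the region r/(t+1)≤1/4. -/

import Mathlib

noncomputable section
open MeasureTheory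

abbrev E3 : Type := EuclideanSpace ℝ (Fin 3)
abbrev Spt : Type := ℝ × E3

/-- The coordinate basis directions of `ℝ^{1+3}`. -/
def dir (a : Fin 4) : Spt :=
  Fin.cases ((1:ℝ), (0:E3)) (fun i => ((0:ℝ), EuclideanSpace.single i (1:ℝ))) a

/-- Coordinate partial derivative `∂_a`. -/
def pd (a : Fin 4) (f : Spt → ℝ) (p : Spt) : ℝ := fderiv ℝ f p (dir a)

def toVec (c : Fin 4 → ℝ) : Spt := ∑ a : Fin 4, c a • dir a

/-- The japanese bracket `⟨s⟩ = 1 + |s|`. -/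
def jap (s : ℝ) : ℝ := 1 + |s|

/-- ω = x/|x| -/
def omg (p : Spt) : E3 := ‖p.2‖⁻¹ • p.2

def Ldir (p : Spt) : Spt := ((1:ℝ), omg p)
def Lbardir (p : Spt) : Spt := ((1:ℝ), -omg p)
def qdir (p : Spt) : Spt := (-(1:ℝ)/2, (2⁻¹:ℝ) • omg p)
def angDir (i : Fin 3) (p : Spt) : Spt :=
  ((0:ℝ), EuclideanSpace.single i (1:ℝ) - omg p i • omg p)

/-- The Minkowski metric (= its inverse) `diag(-1,1,1,1)`. -/
def eta (a b : Fin 4) : ℝ := if a = b then (if a = 0 then -1 else 1) else 0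

def Llow (p : Spt) (a : Fin 4) : ℝ := Fin.cases (-1:ℝ) (fun i => omg p i) a
def Lup (p : Spt) (a : Fin 4) : ℝ := Fin.cases (1:ℝ) (fun i => omg p i) a
def Lbarlow (p : Spt) (a : Fin 4) : ℝ := Fin.cases (-1:ℝ) (fun i => -omg p i) a
def Lbarup (p : Spt) (a : Fin 4) : ℝ := Fin.cases (1:ℝ) (fun i => -omg p i) a

/-- Index type for the Minkowski commuting vector fields: translations,
rotations/boosts, scaling. -/
abbrev ZIdx : Type := Fin 4 ⊕ (Fin 4 × Fin 4) ⊕ Unit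

def xlow (p : Spt) (a : Fin 4) : ℝ := Fin.cases (-p.1) (fun i => p.2 i) a
def xup (p : Spt) (a : Fin 4) : ℝ := Fin.cases p.1 (fun i => p.2 i) a

/-- The components of the Minkowski commuting vector fields. -/
def zfield : ZIdx → Spt → Fin 4 → ℝ
  | Sum.inl a => fun _ c => if c = a then 1 else 0
  | Sum.inr (Sum.inl ab) => fun p c =>
      xlow p ab.1 * (if c = ab.2 then 1 else 0) - xlow p ab.2 * (if c = ab.1 then 1 else 0)
  | Sum.inr (Sum.inr _) => fun p => xup p

/-- `Z^I` applied to a scalar function. -/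
def zApply : {k : ℕ} → (Fin k → ZIdx) → (Spt → ℝ) → Spt → ℝ
  | 0, _, f => f
  | _+1, I, f => fun p => fderiv ℝ (zApply (fun j => I j.succ) f) p (toVec (zfield (I 0) p))

/-- `∂^β` applied to a scalar function. -/
def pdT : {k : ℕ} → (Fin k → Fin 4) → (Spt → ℝ) → Spt → ℝ
  | 0, _, f => f
  | _+1, β, f => pd (β 0) (pdT (fun j => β j.succ) f)

def pdd (a b : Fin 4) (f : Spt → ℝ) : Spt → ℝ := pd a (pd b f)

/-- The flat wave operator `□ = -∂_t² + Δ`. -/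
def box (f : Spt → ℝ) (p : Spt) : ℝ := -(pdd 0 0 f p) + ∑ i : Fin 3, pdd i.succ i.succ f p


/-- Kronecker delta. -/
def kron (a b : Fin 4) : ℝ := if a = b then 1 else 0

/-- The asymptotically Schwarzschild coordinates `x̃⁰ = t`,
`x̃^i = x^i + M ω^i χ(r/(t+1)) ln r`. -/
def xt (M : ℝ) (χ : ℝ → ℝ) (a : Fin 4) : Spt → ℝ :=
  Fin.cases (fun p : Spt => p.1)
    (fun i => fun p : Spt =>
      p.2 i + M * (p.2 i / ‖p.2‖) * χ (‖p.2‖ / (p.1 + 1)) * Real.log ‖p.2‖) a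

/-- The Jacobian `A^a_α = ∂x̃^a/∂x^α`. -/
def Amat (M : ℝ) (χ : ℝ → ℝ) (p : Spt) : Matrix (Fin 4) (Fin 4) ℝ :=
  Matrix.of fun a α => pd α (xt M χ a) p

/-- The inverse Jacobian `A^α_a`. -/
def Ainv (M : ℝ) (χ : ℝ → ℝ) (p : Spt) : Matrix (Fin 4) (Fin 4) ℝ := (Amat M χ p)⁻¹

/-- The region in which the symbol estimates are carried out. -/
def Wset : Set Spt := {p | -(1/2:ℝ) < p.1 ∧ p.1 + 1 < 8 * ‖p.2‖}

theorem Wset_open : IsOpen Wset := by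
  apply IsOpen.inter
  · exact isOpen_lt continuous_const continuous_fst
  · exact isOpen_lt (f := fun p : Spt => p.1 + 1) (g := fun p : Spt => 8 * ‖p.2‖)
      (by fun_prop) (by fun_prop)

theorem Wset_r {p : Spt} (h : p ∈ Wset) : 1/16 < ‖p.2‖ := by
  have h1 := h.1; have h2 := h.2; linarith

theorem Wset_pos {p : Spt} (h : p ∈ Wset) : 0 < ‖p.2‖ := by
  have := Wset_r h; linarith

theorem Wset_ne {p : Spt} (h : p ∈ Wset) : p.2 ≠ 0 := norm_pos_iff.1 (Wset_pos h)

/-- Symbol estimates up to order `n` with weight `w`. -/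
def TN {ι : Type} : ℕ → (ι → Spt → ℝ) → (ι → Spt → ℝ) → Prop
  | 0, w, f => ∃ C : ℝ, ∀ m, ∀ p ∈ Wset, |f m p| ≤ C * w m p
  | n+1, w, f => (∃ C : ℝ, ∀ m, ∀ p ∈ Wset, |f m p| ≤ C * w m p) ∧
      (∀ m, DifferentiableOn ℝ (f m) Wset) ∧
      ∀ a, TN n (fun m p => w m p / ‖p.2‖) (fun m => pd a (f m))

theorem TN.bound {ι : Type} {n : ℕ} {w f : ι → Spt → ℝ} (h : TN n w f) :
    ∃ C : ℝ, ∀ m, ∀ p ∈ Wset, |f m p| ≤ C * w m p := by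
  cases n with
  | zero => exact h
  | succ n => exact h.1

theorem TN.pred {ι : Type} {n : ℕ} {w f : ι → Spt → ℝ} (h : TN (n+1) w f) : TN n w f := by
  induction n generalizing w f with
  | zero => exact h.1
  | succ n ih => exact ⟨h.1, h.2.1, fun a => ih (h.2.2 a)⟩

theorem pd_congr {f g : Spt → ℝ} (h : ∀ p ∈ Wset, f p = g p) (a : Fin 4) :
    ∀ p ∈ Wset, pd a f p = pd a g p := by
  intro p hp
  unfold pd
  have : f =ᶠ[nhds p] g := by
    filter_upwards [Wset_open.mem_nhds hp] with q hq using h q hq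
  rw [this.fderiv_eq]

theorem TN.congr {ι : Type} {n : ℕ} {w f g : ι → Spt → ℝ} (hf : TN n w f)
    (h : ∀ m, ∀ p ∈ Wset, g m p = f m p) : TN n w g := by
  induction n generalizing w f g with
  | zero =>
    obtain ⟨C, hC⟩ := hf
    exact ⟨C, fun m p hp => by rw [h m p hp]; exact hC m p hp⟩
  | succ n ih =>
    obtain ⟨⟨C, hC⟩, hd, h2⟩ := hf
    refine ⟨⟨C, fun m p hp => by rw [h m p hp]; exact hC m p hp⟩, fun m => (hd m).congr (h m),
      fun a => ih (h2 a) fun m => pd_congr (h m) a⟩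

theorem TN.mono {ι : Type} {n : ℕ} {w v f : ι → Spt → ℝ} (hf : TN n w f) (K : ℝ)
    (h : ∀ m, ∀ p ∈ Wset, |w m p| ≤ K * v m p) : TN n v f := by
  have key : ∀ {w v f : ι → Spt → ℝ}, (∀ m, ∀ p ∈ Wset, |w m p| ≤ K * v m p) →
      (∃ C : ℝ, ∀ m, ∀ p ∈ Wset, |f m p| ≤ C * w m p) →
      (∃ C : ℝ, ∀ m, ∀ p ∈ Wset, |f m p| ≤ C * v m p) := by
    rintro w v f h ⟨C, hC⟩
    refine ⟨|C| * K, fun m p hp => (hC m p hp).trans ?_⟩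
    calc C * w m p ≤ |C * w m p| := le_abs_self _
      _ = |C| * |w m p| := abs_mul _ _
      _ ≤ |C| * (K * v m p) := by gcongr; exact h m p hp
      _ = _ := by ring
  induction n generalizing w v f with
  | zero => exact key h hf
  | succ n ih =>
    refine ⟨key h hf.1, hf.2.1, fun a => ih (hf.2.2 a) fun m p hp => ?_⟩
    have := Wset_pos hp
    rw [abs_div, abs_of_pos this, ← mul_div_assoc]
    gcongr; exact h m p hp

theorem TN.weq {ι : Type} {n : ℕ} {w v f : ι → Spt → ℝ} (hf : TN n w f)
    (h : ∀ m, ∀ p ∈ Wset, w m p = v m p) : TN n v f := by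
  have key : ∀ {w v f : ι → Spt → ℝ}, (∀ m, ∀ p ∈ Wset, w m p = v m p) →
      (∃ C : ℝ, ∀ m, ∀ p ∈ Wset, |f m p| ≤ C * w m p) →
      (∃ C : ℝ, ∀ m, ∀ p ∈ Wset, |f m p| ≤ C * v m p) := by
    rintro w v f h ⟨C, hC⟩
    exact ⟨C, fun m p hp => by rw [← h m p hp]; exact hC m p hp⟩
  induction n generalizing w v f with
  | zero => exact key h hf
  | succ n ih =>
    exact ⟨key h hf.1, hf.2.1, fun a => ih (hf.2.2 a) fun m p hp => by rw [h m p hp]⟩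

theorem TN.zero {ι : Type} (n : ℕ) (w : ι → Spt → ℝ) : TN n w (fun _ _ => 0) := by
  induction n generalizing w with
  | zero => exact ⟨0, fun m p _ => by simp⟩
  | succ n ih =>
    refine ⟨⟨0, fun m p _ => by simp⟩, fun m => differentiableOn_const _, fun a => ?_⟩
    exact (ih _).congr fun m p hp => by simp [pd]

theorem TN.const {ι : Type} (n : ℕ) (c : ι → ℝ) : TN n (fun m _ => |c m|) (fun m _ => c m) := by
  cases n with
  | zero => exact ⟨1, fun m p _ => by simp⟩
  | succ n =>
    refine ⟨⟨1, fun m p _ => by simp⟩, fun m => differentiableOn_const _, fun a => ?_⟩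
    exact (TN.zero _ _).congr fun m p hp => by simp [pd]

theorem TN.const1 {ι : Type} (n : ℕ) (c : ℝ) : TN (ι := ι) n (fun _ _ => 1) (fun _ _ => c) :=
  (TN.const n (fun _ => c)).mono |c| (by simp)

theorem diffAt {f : Spt → ℝ} (h : DifferentiableOn ℝ f Wset) {p : Spt} (hp : p ∈ Wset) :
    DifferentiableAt ℝ f p := h.differentiableAt (Wset_open.mem_nhds hp)

theorem TN.add {ι : Type} {n : ℕ} {w f g : ι → Spt → ℝ} (hf : TN n w f) (hg : TN n w g) :
    TN n w (fun m p => f m p + g m p) := by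
  have key : ∀ {w f g : ι → Spt → ℝ}, 
      (∃ C : ℝ, ∀ m, ∀ p ∈ Wset, |f m p| ≤ C * w m p) →
      (∃ C : ℝ, ∀ m, ∀ p ∈ Wset, |g m p| ≤ C * w m p) →
      (∃ C : ℝ, ∀ m, ∀ p ∈ Wset, |f m p + g m p| ≤ C * w m p) := by
    rintro w f g ⟨C, hC⟩ ⟨D, hD⟩
    refine ⟨C + D, fun m p hp => (abs_add_le _ _).trans ?_⟩
    have := hC m p hp; have := hD m p hp
    linarith
  induction n generalizing w f g with
  | zero => exact key hf hg
  | succ n ih =>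
    refine ⟨key hf.1 hg.1, fun m => (hf.2.1 m).add (hg.2.1 m), fun a => ?_⟩
    refine (ih (hf.2.2 a) (hg.2.2 a)).congr fun m p hp => ?_
    unfold pd
    rw [fderiv_fun_add (diffAt (hf.2.1 m) hp) (diffAt (hg.2.1 m) hp)]
    rfl

theorem TN.mul {ι : Type} {n : ℕ} {w v f g : ι → Spt → ℝ} (hf : TN n w f) (hg : TN n v g) :
    TN n (fun m p => w m p * v m p) (fun m p => f m p * g m p) := by
  have key : ∀ {w v f g : ι → Spt → ℝ}, 
      (∃ C : ℝ, ∀ m, ∀ p ∈ Wset, |f m p| ≤ C * w m p) →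
      (∃ C : ℝ, ∀ m, ∀ p ∈ Wset, |g m p| ≤ C * v m p) →
      (∃ C : ℝ, ∀ m, ∀ p ∈ Wset, |f m p * g m p| ≤ C * (w m p * v m p)) := by
    rintro w v f g ⟨C, hC⟩ ⟨D, hD⟩
    refine ⟨C * D, fun m p hp => ?_⟩
    rw [abs_mul]
    have h1 := hC m p hp; have h2 := hD m p hp
    calc |f m p| * |g m p| ≤ (C * w m p) * (D * v m p) :=
          mul_le_mul h1 h2 (abs_nonneg _) ((abs_nonneg _).trans h1)
      _ = _ := by ring
  induction n generalizing w v f g with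
  | zero => exact key hf hg
  | succ n ih =>
    refine ⟨key hf.1 hg.1, fun m => (hf.2.1 m).mul (hg.2.1 m), fun a => ?_⟩
    have h1 := (ih hf.pred (hg.2.2 a)).weq (v := fun m p => w m p * v m p / ‖p.2‖)
      (fun m p hp => by ring)
    have h2 := (ih (hf.2.2 a) hg.pred).weq (v := fun m p => w m p * v m p / ‖p.2‖)
      (fun m p hp => by ring)
    refine (h1.add h2).congr fun m p hp => ?_
    unfold pd
    rw [fderiv_fun_mul (diffAt (hf.2.1 m) hp) (diffAt (hg.2.1 m) hp)]
    simp [mul_comm]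

/-- Symbols. -/
def Sy {ι : Type} (w f : ι → Spt → ℝ) : Prop := ∀ n, TN n w f

theorem Sy.sum {ι κ : Type} (s : Finset κ) {w : ι → Spt → ℝ} {f : κ → ι → Spt → ℝ}
    (h : ∀ k ∈ s, Sy w (f k)) : Sy w (fun m p => ∑ k ∈ s, f k m p) := by
  classical
  induction s using Finset.induction_on with
  | empty => intro n; simpa using TN.zero n w
  | insert a s ha ih =>
    intro n
    simp only [Finset.sum_insert ha]
    exact (h a (by simp) n).add (ih (fun k hk => h k (by simp [hk])) n)

theorem Sy.prod {ι κ : Type} (s : Finset κ) {f : κ → ι → Spt → ℝ}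
    (h : ∀ k ∈ s, Sy (fun _ _ => 1) (f k)) : Sy (fun _ _ => 1) (fun m p => ∏ k ∈ s, f k m p) := by
  classical
  induction s using Finset.induction_on with
  | empty => intro n; simpa using TN.const1 n 1
  | insert a s ha ih =>
    intro n
    simp only [Finset.prod_insert ha]
    exact ((h a (by simp) n).mul (ih (fun k hk => h k (by simp [hk])) n)).weq (by simp)

theorem Sy.det {ι : Type} {A : ι → Spt → Matrix (Fin 4) (Fin 4) ℝ}
    (h : ∀ a b, Sy (fun _ _ => 1) (fun m p => A m p a b)) :
    Sy (fun _ _ => 1) (fun m p => (A m p).det) := by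
  simp only [Matrix.det_apply']
  apply Sy.sum
  intro σ _ n
  refine ((TN.const1 n _).mul (Sy.prod _ (fun i _ => h (σ i) i) n)).weq (by simp)

theorem hasF_inv {f : Spt → ℝ} {f' : Spt →L[ℝ] ℝ} {p : Spt} (h : HasFDerivAt f f' p)
    (h0 : f p ≠ 0) : HasFDerivAt (fun q => (f q)⁻¹) ((-(f p ^ 2)⁻¹) • f') p :=
  (hasDerivAt_inv h0).comp_hasFDerivAt p h

theorem TN.inv {ι : Type} {f : ι → Spt → ℝ} {c : ℝ} (hc : 0 < c) (h : Sy (fun _ _ => 1) f)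
    (hf : ∀ m, ∀ p ∈ Wset, c ≤ f m p) (n : ℕ) :
    TN n (fun _ _ => 1) (fun m p => (f m p)⁻¹) := by
  have b : (∃ C : ℝ, ∀ m, ∀ p ∈ Wset, |(f m p)⁻¹| ≤ C * 1) := by
    refine ⟨c⁻¹, fun m p hp => ?_⟩
    have := hf m p hp
    rw [abs_of_pos (inv_pos.2 (by linarith)), mul_one]
    gcongr
  induction n with
  | zero => exact b
  | succ n ih =>
    refine ⟨b, fun m p hp => ((h 1).2.1 m p hp).inv (by have := hf m p hp; linarith), fun a => ?_⟩
    have h1 := (TN.const1 (ι := ι) n (-1)).mul (((h (n+1)).2.2 a).mul (ih.mul ih))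
    refine (h1.weq (by simp)).congr fun m p hp => ?_
    unfold pd
    have hne : f m p ≠ 0 := by have := hf m p hp; linarith
    have := (hasF_inv (diffAt ((h 1).2.1 m) hp).hasFDerivAt hne).fderiv
    rw [this]
    simp
    field_simp

theorem Sy.adj {ι : Type} {A : ι → Spt → Matrix (Fin 4) (Fin 4) ℝ}
    (h : ∀ a b, Sy (fun _ _ => 1) (fun m p => A m p a b)) {c : ℝ} (hc : 0 < c)
    (hd : ∀ m, ∀ p ∈ Wset, c ≤ (A m p).det) (i j : Fin 4) :
    Sy (fun _ _ => 1) (fun m p => (A m p)⁻¹ i j) := by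
  intro n
  have h1 : Sy (fun _ _ => 1) (fun m p => (A m p).adjugate i j) := by
    simp only [Matrix.adjugate_apply]
    apply Sy.det
    intro a b
    by_cases hab : a = j
    · subst hab
      intro n
      simpa using TN.const1 n _
    · simpa [Matrix.updateRow_ne hab] using h a b
  have h2 := TN.inv hc (Sy.det h) hd n
  refine ((h2.mul (h1 n)).weq (by simp)).congr fun m p hp => ?_
  rw [Matrix.inv_def]
  simp [Ring.inverse_eq_inv']

def yc (a : Fin 4) (p : Spt) : ℝ := Fin.cases 0 (fun i => p.2 i) a

theorem coord_hasF (i : Fin 3) (p : Spt) :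
    HasFDerivAt (fun q : Spt => q.2 i)
      ((EuclideanSpace.proj i : E3 →L[ℝ] ℝ).comp (ContinuousLinearMap.snd ℝ ℝ E3)) p :=
  ((EuclideanSpace.proj i : E3 →L[ℝ] ℝ).comp (ContinuousLinearMap.snd ℝ ℝ E3)).hasFDerivAt

theorem pd_coord (i : Fin 3) (a : Fin 4) (p : Spt) :
    pd a (fun q : Spt => q.2 i) p = kron i.succ a := by
  unfold pd
  rw [(coord_hasF i p).fderiv]
  refine Fin.cases ?_ (fun j => ?_) a
  · simp [dir, kron]
  · simp [dir, kron, Fin.succ_inj]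

theorem pd_t (a : Fin 4) (p : Spt) : pd a (fun q : Spt => q.1) p = kron 0 a := by
  unfold pd
  rw [(hasFDerivAt_fst (𝕜 := ℝ) (p := p)).fderiv]
  refine Fin.cases ?_ (fun j => ?_) a
  · simp [dir, kron]
  · simp [dir, kron, (Fin.succ_ne_zero j).symm]

theorem norm_hasF {p : Spt} (hp : p.2 ≠ 0) :
    HasFDerivAt (fun q : Spt => ‖q.2‖)
      (‖p.2‖⁻¹ • ((innerSL ℝ p.2).comp (ContinuousLinearMap.snd ℝ ℝ E3))) p := by
  have h1 : HasFDerivAt (fun q : Spt => ‖q.2‖ ^ 2) _ p :=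
    (hasFDerivAt_snd (𝕜 := ℝ) (p := p)).norm_sq
  have h2 := h1.sqrt (by simpa using hp)
  simp only [Real.sqrt_sq (norm_nonneg _)] at h2
  refine h2.congr_fderiv ?_
  rw [← Nat.cast_smul_eq_nsmul ℝ, smul_smul]
  congr 1
  field_simp
  norm_num

theorem norm_dir (a : Fin 4) (p : Spt) : (innerSL ℝ p.2) (dir a).2 = yc a p := by
  refine Fin.cases ?_ (fun j => ?_) a
  · simp [dir, yc]
  · simp [dir, yc, EuclideanSpace.inner_single_right]

theorem abs_coord (i : Fin 3) (p : Spt) : |p.2 i| ≤ ‖p.2‖ := by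
  simpa using PiLp.norm_apply_le p.2 i

variable {ι : Type}

theorem TN.coord (n : ℕ) (i : Fin 3) :
    TN (ι := ι) n (fun _ p => ‖p.2‖) (fun _ p => p.2 i) := by
  have b : ∃ C : ℝ, ∀ m : ι, ∀ p ∈ Wset, |p.2 i| ≤ C * ‖p.2‖ :=
    ⟨1, fun m p _ => by simpa using abs_coord i p⟩
  cases n with
  | zero => exact b
  | succ n =>
    refine ⟨b, fun m p _ => (coord_hasF i p).differentiableAt.differentiableWithinAt, fun a => ?_⟩
    exact ((TN.const1 n (kron i.succ a)).congr fun m p _ => pd_coord i a p).weq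
      fun m p hp => (div_self (Wset_pos hp).ne').symm

theorem TN.time (n : ℕ) :
    TN (ι := ι) n (fun _ p => ‖p.2‖) (fun _ p => p.1) := by
  have b : ∃ C : ℝ, ∀ m : ι, ∀ p ∈ Wset, |p.1| ≤ C * ‖p.2‖ :=
    ⟨8, fun m p h => by have := h.1; have := h.2; rw [abs_le]; constructor <;> linarith⟩
  cases n with
  | zero => exact b
  | succ n =>
    refine ⟨b, fun m => differentiableOn_fst, fun a => ?_⟩
    exact ((TN.const1 n (kron 0 a)).congr fun m p _ => pd_t a p).weq
      fun m p hp => (div_self (Wset_pos hp).ne').symm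

theorem TN.constr (n : ℕ) (c : ℝ) :
    TN (ι := ι) n (fun _ p => ‖p.2‖) (fun _ _ => c) :=
  (TN.const1 n c).mono 16 fun m p hp => by have := Wset_r hp; rw [abs_one]; linarith

theorem TN.yc (n : ℕ) (a : Fin 4) :
    TN (ι := ι) n (fun _ p => ‖p.2‖) (fun _ p => yc a p) := by
  refine Fin.cases ?_ (fun j => ?_) a
  · exact TN.zero _ _
  · exact TN.coord _ _

theorem TN.rinv (n : ℕ) :
    TN (ι := ι) n (fun _ p => ‖p.2‖⁻¹) (fun _ p => ‖p.2‖⁻¹) := by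
  have b : ∃ C : ℝ, ∀ m : ι, ∀ p ∈ Wset, |‖p.2‖⁻¹| ≤ C * ‖p.2‖⁻¹ :=
    ⟨1, fun m p h => by simp⟩
  induction n with
  | zero => exact b
  | succ n ih =>
    refine ⟨b, fun m p hp => (hasF_inv (norm_hasF (Wset_ne hp))
      (Wset_pos hp).ne').differentiableAt.differentiableWithinAt, fun a => ?_⟩
    have h1 := (TN.const1 (ι := ι) n (-1)).mul ((TN.yc n a).mul (ih.mul (ih.mul ih)))
    refine (h1.weq ?_).congr fun m p hp => ?_
    · intro m p hp
      have := (Wset_pos hp).ne'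
      field_simp
    · unfold pd
      rw [(hasF_inv (norm_hasF (Wset_ne hp)) (Wset_pos hp).ne').fderiv]
      have := (Wset_pos hp).ne'
      have h := norm_dir a p
      simp only [innerSL_apply_apply] at h
      simp [h]
      field_simp

/-- weight -/
def lw (p : Spt) : ℝ := 1 + |Real.log ‖p.2‖|

theorem lw_one (p : Spt) : 1 ≤ lw p := by unfold lw; linarith [abs_nonneg (Real.log ‖p.2‖)]

theorem TN.logr (n : ℕ) :
    TN (ι := ι) n (fun _ p => lw p) (fun _ p => Real.log ‖p.2‖) := by
  have b : ∃ C : ℝ, ∀ m : ι, ∀ p ∈ Wset, |Real.log ‖p.2‖| ≤ C * lw p :=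
    ⟨1, fun m p h => by simp [lw]⟩
  cases n with
  | zero => exact b
  | succ n =>
    refine ⟨b, fun m p hp => ((norm_hasF (Wset_ne hp)).log
      (Wset_pos hp).ne').differentiableAt.differentiableWithinAt, fun a => ?_⟩
    have h1 := ((TN.yc (ι := ι) n a).mul ((TN.rinv n).mul (TN.rinv n)))
    refine (h1.mono 1 ?_).congr fun m p hp => ?_
    · intro m p hp
      have := (Wset_pos hp)
      rw [mul_inv_cancel_left₀ this.ne', abs_of_pos (by positivity), one_mul, inv_eq_one_div]
      gcongr
      exact lw_one p
    · unfold pd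
      rw [((norm_hasF (Wset_ne hp)).log (Wset_pos hp).ne').fderiv]
      have := (Wset_pos hp).ne'
      have h := norm_dir a p
      simp only [innerSL_apply_apply] at h
      simp [h]
      field_simp

def sg (p : Spt) : ℝ := (p.1 + 1) * ‖p.2‖⁻¹

theorem sg_mem {p : Spt} (hp : p ∈ Wset) : sg p ∈ Set.Icc (0:ℝ) 8 := by
  have h0 := Wset_pos hp
  have h1 := hp.1; have h2 := hp.2
  unfold sg
  rw [← div_eq_mul_inv]
  exact ⟨div_nonneg (by linarith) h0.le, by rw [div_le_iff₀ h0]; exact h2.le⟩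

theorem TN.sg (n : ℕ) : TN (ι := ι) n (fun _ _ => 1) (fun _ p => sg p) :=
  (((TN.time n).add (TN.constr n 1)).mul (TN.rinv n)).weq
    fun m p hp => mul_inv_cancel₀ (Wset_pos hp).ne'

theorem TN.psi (n : ℕ) {ψ : ℝ → ℝ} (hψ : ContDiff ℝ (⊤:ℕ∞) ψ) :
    TN (ι := ι) n (fun _ _ => 1) (fun _ p => ψ (_root_.sg p)) := by
  have b : ∀ {ψ : ℝ → ℝ}, ContDiff ℝ (⊤:ℕ∞) ψ →
      ∃ C : ℝ, ∀ m : ι, ∀ p ∈ Wset, |ψ (_root_.sg p)| ≤ C * 1 := by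
    intro ψ hψ
    obtain ⟨C, hC⟩ := (isCompact_Icc (a := (0:ℝ)) (b := 8)).exists_bound_of_continuousOn
      hψ.continuous.continuousOn
    exact ⟨C, fun m p hp => by simpa using hC _ (sg_mem hp)⟩
  induction n generalizing ψ with
  | zero => exact b hψ
  | succ n ih =>
    by_cases hι : Nonempty ι
    swap
    · rw [not_nonempty_iff] at hι
      exact (TN.zero (n+1) _).congr fun m => (hι.false m).elim
    obtain ⟨m0⟩ := hι
    have hs : ∀ p ∈ Wset, DifferentiableAt ℝ _root_.sg p := fun p hp =>
      diffAt ((TN.sg (ι := ι) 1).2.1 m0) hp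
    have hd := contDiff_infty_iff_deriv.1 hψ
    have hc : ∀ p ∈ Wset, HasFDerivAt (fun q => ψ (_root_.sg q)) _ p := fun p hp =>
      (hd.1 (_root_.sg p)).hasDerivAt.comp_hasFDerivAt p (hs p hp).hasFDerivAt
    refine ⟨b hψ, fun m p hp => (hc p hp).differentiableAt.differentiableWithinAt, fun a => ?_⟩
    refine (((ih hd.2).mul ((TN.sg (n+1)).2.2 a)).weq (by simp)).congr fun m p hp => ?_
    unfold pd
    rw [(hc p hp).fderiv]
    simp

theorem zApply_succ {k : ℕ} (I : Fin (k+1) → ZIdx) (f : Spt → ℝ) (p : Spt) :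
    zApply I f p = ∑ a : Fin 4, zfield (I 0) p a * pd a (zApply (fun j => I j.succ) f) p := by
  simp [zApply, toVec, pd, map_sum]

theorem Sy.xlow (a : Fin 4) : Sy (ι := ι) (fun _ p => ‖p.2‖) (fun _ p => xlow p a) := by
  intro n
  refine Fin.cases ?_ (fun j => ?_) a
  · refine (((TN.const1 n (-1)).mul (TN.time n)).weq (by simp)).congr ?_
    simp [_root_.xlow]
  · exact TN.coord n j

theorem Sy.xup (a : Fin 4) : Sy (ι := ι) (fun _ p => ‖p.2‖) (fun _ p => xup p a) := by
  intro n
  refine Fin.cases ?_ (fun j => ?_) a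
  · exact TN.time n
  · exact TN.coord n j

theorem Sy.zfield (z : ZIdx) (a : Fin 4) :
    Sy (ι := ι) (fun _ p => ‖p.2‖) (fun _ p => zfield z p a) := by
  intro n
  rcases z with b | ⟨b, c⟩ | _
  · exact TN.constr n _
  · have h1 := ((Sy.xlow (ι := ι) b n).mul (TN.const1 n (if a = c then 1 else 0))).weq
      (v := fun _ p => ‖p.2‖) (by simp)
    have h2 := ((Sy.xlow (ι := ι) c n).mul (TN.const1 n (-(if a = b then 1 else 0)))).weq
      (v := fun _ p => ‖p.2‖) (by simp)
    refine (h1.add h2).congr fun m p hp => ?_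
    simp only [_root_.zfield]
    ring
  · exact Sy.xup a n

theorem Sy.zApply {w f : ι → Spt → ℝ} (h : Sy w f) {k : ℕ} (I : Fin k → ZIdx) :
    Sy w (fun m => zApply I (f m)) := by
  induction k with
  | zero => exact h
  | succ k ih =>
    have hh := ih (fun j => I j.succ)
    have : Sy w (fun m p => ∑ a : Fin 4, _root_.zfield (I 0) p a *
        pd a (_root_.zApply (fun j => I j.succ) (f m)) p) := by
      apply Sy.sum
      intro a _ n
      exact ((Sy.zfield (I 0) a n).mul ((hh (n+1)).2.2 a)).weq fun m p hp =>
        mul_div_cancel₀ _ (Wset_pos hp).ne'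
    intro n
    exact (this n).congr fun m p _ => zApply_succ I (f m) p

def psi (χ : ℝ → ℝ) (s : ℝ) : ℝ := if s ≤ 1 then 1 else χ s⁻¹

theorem psi_eq {χ : ℝ → ℝ} (hχ1 : ∀ s, (3:ℝ)/4 ≤ s → χ s = 1) {s : ℝ} (hs : 0 < s) :
    psi χ s = χ s⁻¹ := by
  unfold psi
  split_ifs with h
  · rw [hχ1]
    have := (one_le_inv₀ hs).2 h
    linarith
  · rfl

theorem psi_smooth {χ : ℝ → ℝ} (hχ : ContDiff ℝ (⊤:ℕ∞) χ)
    (hχ1 : ∀ s, (3:ℝ)/4 ≤ s → χ s = 1) : ContDiff ℝ (⊤:ℕ∞) (psi χ) := by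
  rw [contDiff_iff_contDiffAt]
  intro x
  by_cases hx : 0 < x
  · have h1 : ContDiffAt ℝ (⊤:ℕ∞) (fun s => χ s⁻¹) x :=
      hχ.contDiffAt.comp x (contDiffAt_inv ℝ hx.ne')
    refine h1.congr_of_eventuallyEq ?_
    filter_upwards [lt_mem_nhds hx] with s hs using psi_eq hχ1 hs
  · have h1 : ContDiffAt ℝ (⊤:ℕ∞) (fun _ : ℝ => (1:ℝ)) x := contDiffAt_const
    refine h1.congr_of_eventuallyEq ?_
    filter_upwards [gt_mem_nhds (show x < 1 by linarith)] with s hs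
    simp [psi, le_of_lt hs]

def FF (χ : ℝ → ℝ) (i : Fin 3) (p : Spt) : ℝ :=
  p.2 i * ‖p.2‖⁻¹ * psi χ (sg p) * Real.log ‖p.2‖

def BB (χ : ℝ → ℝ) (a α : Fin 4) (p : Spt) : ℝ :=
  Fin.cases 0 (fun i => pd α (FF χ i) p) a

theorem Sy.FF {χ : ℝ → ℝ} (hχ : ContDiff ℝ (⊤:ℕ∞) χ)
    (hχ1 : ∀ s, (3:ℝ)/4 ≤ s → χ s = 1) (i : Fin 3) :
    Sy (ι := ι) (fun _ p => lw p) (fun _ p => FF χ i p) := by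
  intro n
  refine ((((TN.coord n i).mul (TN.rinv n)).mul (TN.psi n (psi_smooth hχ hχ1))).mul
    (TN.logr n)).weq fun m p hp => ?_
  rw [mul_inv_cancel₀ (Wset_pos hp).ne']
  ring

theorem Sy.BB {χ : ℝ → ℝ} (hχ : ContDiff ℝ (⊤:ℕ∞) χ)
    (hχ1 : ∀ s, (3:ℝ)/4 ≤ s → χ s = 1) (a α : Fin 4) :
    Sy (ι := ι) (fun _ p => lw p / ‖p.2‖) (fun _ p => BB χ a α p) := by
  intro n
  refine Fin.cases ?_ (fun j => ?_) a
  · exact TN.zero _ _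
  · exact (Sy.FF hχ hχ1 j (n+1)).2.2 α

theorem Amat_W {χ : ℝ → ℝ} (hχ : ContDiff ℝ (⊤:ℕ∞) χ)
    (hχ1 : ∀ s, (3:ℝ)/4 ≤ s → χ s = 1) (M : ℝ) {p : Spt} (hp : p ∈ Wset) (a α : Fin 4) :
    Amat M χ p a α = kron a α + M * BB χ a α p := by
  simp only [Amat, Matrix.of_apply]
  refine Fin.cases ?_ (fun i => ?_) a
  · simp only [xt, BB, Fin.cases_zero, mul_zero, add_zero]
    exact pd_t α p
  · simp only [BB, Fin.cases_succ]
    have h1 : ∀ q ∈ Wset, xt M χ i.succ q = q.2 i + M * FF χ i q := by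
      intro q hq
      have h0 := Wset_pos hq
      have hs : 0 < sg q := mul_pos (by have := hq.1; linarith) (inv_pos.2 h0)
      simp only [xt, Fin.cases_succ, FF]
      rw [psi_eq hχ1 hs]
      have : (sg q)⁻¹ = ‖q.2‖ / (q.1 + 1) := by
        unfold sg; rw [mul_inv, inv_inv, div_eq_mul_inv, mul_comm]
      rw [this]; ring
    rw [pd_congr h1 α p hp, ← pd_coord i α p]
    have hF : DifferentiableAt ℝ (FF χ i) p :=
      diffAt ((Sy.FF (ι := Unit) hχ hχ1 i 1).2.1 ()) hp
    unfold pd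
    rw [fderiv_fun_add (coord_hasF i p).differentiableAt (hF.const_mul M),
      fderiv_const_mul hF]
    simp

def Vset : Set Spt := {p | -1 < p.1 ∧ ‖p.2‖ < (p.1 + 1) / 4}

theorem Vset_open : IsOpen Vset := by
  apply IsOpen.inter
  · exact isOpen_lt continuous_const continuous_fst
  · exact isOpen_lt (f := fun p : Spt => ‖p.2‖) (g := fun p : Spt => (p.1 + 1) / 4)
      (by fun_prop) (by fun_prop)

theorem Amat_V {χ : ℝ → ℝ} (hχ0 : ∀ s ≤ (1:ℝ)/4, χ s = 0) (M : ℝ) {p : Spt} (hp : p ∈ Vset)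
    (a α : Fin 4) : Amat M χ p a α = kron a α := by
  simp only [Amat, Matrix.of_apply]
  refine Fin.cases ?_ (fun i => ?_) a
  · exact pd_t α p
  · rw [← pd_coord i α p]
    unfold pd
    have : xt M χ i.succ =ᶠ[nhds p] fun q => q.2 i := by
      filter_upwards [Vset_open.mem_nhds hp] with q hq
      have h1 := hq.1; have h2 := hq.2
      simp only [xt, Fin.cases_succ]
      rw [hχ0]
      · ring
      · rw [div_le_iff₀ (by linarith)]; linarith
    rw [this.fderiv_eq]

theorem Amat_one {χ : ℝ → ℝ} {M : ℝ} {p : Spt} (h : ∀ a α, Amat M χ p a α = kron a α) :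
    Amat M χ p = 1 := by
  ext a α
  rw [h, Matrix.one_apply]; rfl

theorem Ainv_one {χ : ℝ → ℝ} {M : ℝ} {p : Spt} (h : ∀ a α, Amat M χ p a α = kron a α)
    (a α : Fin 4) : Ainv M χ p a α = kron a α := by
  rw [Ainv, Amat_one h, inv_one, Matrix.one_apply]; rfl

theorem zApply_zero {f : Spt → ℝ} (hf : ∀ p ∈ Vset, f p = 0) {k : ℕ} (I : Fin k → ZIdx) :
    ∀ p ∈ Vset, zApply I f p = 0 := by
  induction k with
  | zero => exact hf
  | succ k ih =>
    intro p hp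
    have : zApply (fun j => I j.succ) f =ᶠ[nhds p] fun _ => 0 := by
      filter_upwards [Vset_open.mem_nhds hp] with q hq using ih _ q hq
    simp only [zApply]
    rw [this.fderiv_eq]
    simp

theorem det_near : ∃ ε : ℝ, 0 < ε ∧ ∀ A : Matrix (Fin 4) (Fin 4) ℝ,
    (∀ a b, |A a b - kron a b| < ε) → 1/2 ≤ A.det := by
  have hc : Continuous (fun A : Fin 4 → Fin 4 → ℝ => (Matrix.of A).det) :=
    Continuous.matrix_det continuous_id
  obtain ⟨ε, h0, h⟩ := Metric.continuous_iff.1 hc (fun a b => kron a b) (1/2) (by norm_num)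
  refine ⟨ε, h0, fun A hA => ?_⟩
  have h1 := h (fun a b => A a b) (by
    rw [dist_pi_lt_iff h0]; intro a
    rw [dist_pi_lt_iff h0]; intro b
    rw [Real.dist_eq]; exact hA a b)
  have h2 : (Matrix.of fun a b => kron a b) = (1 : Matrix (Fin 4) (Fin 4) ℝ) := by
    ext a b; rw [Matrix.one_apply]; rfl
  rw [h2, Matrix.det_one, Real.dist_eq, abs_lt] at h1
  have h3 : Matrix.det (Matrix.of fun a b => A a b) = A.det := rfl
  rw [h3] at h1
  linarith [h1.1]

theorem lw_bound {p : Spt} (hp : p ∈ Wset) : |lw p / ‖p.2‖| ≤ 273 * 1 := by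
  have h0 := Wset_pos hp
  have h1 := Wset_r hp
  have h2 := lw_one p
  rw [abs_of_nonneg (by positivity), div_le_iff₀ h0]
  have h3 := Real.log_le_sub_one_of_pos h0
  have h4 := Real.one_sub_inv_le_log_of_pos h0
  have h5 : ‖p.2‖⁻¹ ≤ 16 := by
    rw [inv_le_comm₀ h0 (by norm_num)]; linarith
  have : |Real.log ‖p.2‖| ≤ ‖p.2‖ + 16 := by
    rw [abs_le]; constructor <;> linarith
  unfold lw
  linarith

/-- **Vector-field bounds for the Jacobian of the asymptotically Schwarzschild coordinate
change** (Corollary 5.3):  for `0 < M ≤ M₀`,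
`|Z^I(A^a_α - δ^a_α)| + |Z^I(A^α_a - δ^α_a)| ≤ C_I M ⟨ln r⟩ r^{-1}` for `t ≥ 0`, `x ≠ 0`,
and the differences vanish identically where `r/(t+1) ≤ 1/4`. -/
theorem jacobian_vectorfield_bounds
    (χ : ℝ → ℝ) (hχ : ContDiff ℝ (⊤:ℕ∞) χ)
    (hχ0 : ∀ s ≤ (1:ℝ)/4, χ s = 0) (hχ1 : ∀ s, (3:ℝ)/4 ≤ s → χ s = 1)
    (hχb : ∀ s, 0 ≤ χ s ∧ χ s ≤ 1) :
    ∃ M₀ : ℝ, 0 < M₀ ∧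
    (∀ (j : ℕ) (I : Fin j → ZIdx), ∃ C : ℝ, 0 < C ∧
      ∀ M : ℝ, 0 < M → M ≤ M₀ → ∀ p : Spt, 0 ≤ p.1 → p.2 ≠ 0 → ∀ a α : Fin 4,
        |zApply I (fun q => Amat M χ q a α - kron a α) p|
            + |zApply I (fun q => Ainv M χ q α a - kron α a) p|
          ≤ C * M * (1 + |Real.log ‖p.2‖|) / ‖p.2‖) ∧
    (∀ M : ℝ, 0 < M → M ≤ M₀ → ∀ p : Spt, 0 ≤ p.1 → p.2 ≠ 0 →
      ‖p.2‖ / (p.1 + 1) ≤ 1/4 → ∀ a α : Fin 4,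
        Amat M χ p a α = kron a α ∧ Ainv M χ p α a = kron α a) := by
  obtain ⟨ε, hε, hdet⟩ := det_near
  have hB1 : ∀ a α, ∃ C : ℝ, ∀ p ∈ Wset, |BB χ a α p| ≤ C := by
    intro a α
    obtain ⟨C, hC⟩ := ((Sy.BB (ι := Unit) hχ hχ1 a α 0).mono 273
      (v := fun _ _ => 1) (fun _ p hp => lw_bound hp)).bound
    exact ⟨C, fun p hp => by simpa using hC () p hp⟩
  choose K hK using hB1
  obtain ⟨L, hL0, hL⟩ : ∃ L : ℝ, 0 < L ∧ ∀ a α, ∀ p ∈ Wset, |BB χ a α p| < L := by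
    refine ⟨(∑ a, ∑ α, |K a α|) + 1, by positivity, fun a α p hp => ?_⟩
    have h1 : |K a α| ≤ ∑ α, |K a α| :=
      Finset.single_le_sum (f := fun α => |K a α|) (fun _ _ => abs_nonneg _) (Finset.mem_univ α)
    have h2 : ∑ α, |K a α| ≤ ∑ a, ∑ α, |K a α| :=
      Finset.single_le_sum (f := fun a => ∑ α, |K a α|) (fun _ _ => by positivity)
        (Finset.mem_univ a)
    have := hK a α p hp
    have := le_abs_self (K a α)
    linarith
  refine ⟨min 1 (ε / L), by positivity, ?_, ?_⟩
  · set M₀ : ℝ := min 1 (ε / L) with hM₀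
    let ι : Type := {M : ℝ // 0 < M ∧ M ≤ M₀}
    have hM1 : ∀ m : ι, m.1 ≤ 1 := fun m => m.2.2.trans (min_le_left _ _)
    have hd : ∀ m : ι, ∀ p ∈ Wset, 1/2 ≤ (Amat m.1 χ p).det := by
      intro m p hp
      apply hdet
      intro a b
      rw [Amat_W hχ hχ1 m.1 hp, add_sub_cancel_left, abs_mul, abs_of_pos m.2.1]
      have h1 : m.1 * L ≤ ε := by
        rw [← le_div_iff₀ hL0]; exact m.2.2.trans (min_le_right _ _)
      exact (mul_lt_mul_of_pos_left (hL a b p hp) m.2.1).trans_le h1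
    have hMB : ∀ a α, Sy (ι := ι) (fun m p => m.1 * (lw p / ‖p.2‖))
        (fun m p => m.1 * BB χ a α p) := by
      intro a α n
      exact ((TN.const n (fun m : ι => m.1)).mul (Sy.BB hχ hχ1 a α n)).weq fun m p hp => by
        rw [abs_of_pos m.2.1]
    have hA : ∀ a α, Sy (ι := ι) (fun _ _ => 1) (fun m p => Amat m.1 χ p a α) := by
      intro a α n
      have h1 := (hMB a α n).mono 273 (v := fun _ _ => 1) (fun m p hp => by
        rw [abs_mul, abs_of_pos m.2.1]
        have := lw_bound hp
        nlinarith [hM1 m, m.2.1, abs_nonneg (lw p / ‖p.2‖)])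
      exact ((TN.const1 n (kron a α)).add h1).congr fun m p hp => Amat_W hχ hχ1 m.1 hp a α
    have hAi : ∀ a α, Sy (ι := ι) (fun _ _ => 1) (fun m p => Ainv m.1 χ p a α) :=
      fun a α => Sy.adj hA (by norm_num) hd a α
    have hS1 : ∀ a α, Sy (ι := ι) (fun m p => m.1 * (lw p / ‖p.2‖))
        (fun m p => Amat m.1 χ p a α - kron a α) := fun a α n =>
      (hMB a α n).congr fun m p hp => by rw [Amat_W hχ hχ1 m.1 hp, add_sub_cancel_left]
    have hS2 : ∀ a α, Sy (ι := ι) (fun m p => m.1 * (lw p / ‖p.2‖))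
        (fun m p => Ainv m.1 χ p α a - kron α a) := by
      intro a α
      have h1 : Sy (ι := ι) (fun m p => m.1 * (lw p / ‖p.2‖))
          (fun m p => ∑ b : Fin 4, (-1) * (Ainv m.1 χ p α b * (m.1 * BB χ b a p))) := by
        apply Sy.sum
        intro b _ n
        exact ((TN.const1 n (-1)).mul ((hAi α b n).mul (hMB b a n))).weq fun m p hp => by
          simp
      intro n
      refine (h1 n).congr fun m p hp => ?_
      have hu : IsUnit (Amat m.1 χ p).det := by
        have := hd m p hp
        exact isUnit_iff_ne_zero.2 (by linarith)
      have h2 : Ainv m.1 χ p - 1 = -(Ainv m.1 χ p * (Amat m.1 χ p - 1)) := by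
        rw [mul_sub, mul_one, Ainv, Matrix.nonsing_inv_mul _ hu]; abel
      have h3 := congrFun (congrFun h2 α) a
      have hk : ∀ a b, (1 : Matrix (Fin 4) (Fin 4) ℝ) a b = kron a b := fun a b => by
        rw [Matrix.one_apply]; rfl
      rw [Matrix.sub_apply, hk, Matrix.neg_apply, Matrix.mul_apply, ← Finset.sum_neg_distrib] at h3
      rw [h3]
      refine Finset.sum_congr rfl fun b _ => ?_
      rw [Matrix.sub_apply, hk, Amat_W hχ hχ1 m.1 hp]
      ring
    intro j I
    have e1 := fun a α => (Sy.zApply (hS1 a α) I 0).bound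
    have e2 := fun a α => (Sy.zApply (hS2 a α) I 0).bound
    choose C1 hC1 using e1
    choose C2 hC2 using e2
    refine ⟨(∑ a, ∑ α, (|C1 a α| + |C2 a α|)) + 1, by positivity, ?_⟩
    intro M hM hMM p ht hx a α
    have hr : 0 < ‖p.2‖ := norm_pos_iff.2 hx
    by_cases hp : p ∈ Wset
    · have q1 := hC1 a α ⟨M, hM, hMM⟩ p hp
      have q2 := hC2 a α ⟨M, hM, hMM⟩ p hp
      simp only at q1 q2
      have hw : 0 ≤ M * (lw p / ‖p.2‖) := by
        have := lw_one p
        positivity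
      have h1 : |C1 a α| + |C2 a α| ≤ ∑ α, (|C1 a α| + |C2 a α|) :=
        Finset.single_le_sum (f := fun α => |C1 a α| + |C2 a α|) (fun _ _ => by positivity)
          (Finset.mem_univ α)
      have h2 : ∑ α, (|C1 a α| + |C2 a α|) ≤ ∑ a, ∑ α, (|C1 a α| + |C2 a α|) :=
        Finset.single_le_sum (f := fun a => ∑ α, (|C1 a α| + |C2 a α|))
          (fun _ _ => by positivity) (Finset.mem_univ a)
      have h3 : C1 a α + C2 a α ≤ (∑ a, ∑ α, (|C1 a α| + |C2 a α|)) + 1 := by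
        linarith [le_abs_self (C1 a α), le_abs_self (C2 a α)]
      have h4 := mul_le_mul_of_nonneg_right h3 hw
      refine (add_le_add q1 q2).trans ?_
      rw [← add_mul]
      refine h4.trans (le_of_eq ?_)
      unfold lw
      ring
    · have hV : p ∈ Vset := by
        refine ⟨by linarith, ?_⟩
        have : 8 * ‖p.2‖ ≤ p.1 + 1 := by
          by_contra hc
          exact hp ⟨by linarith, not_le.1 hc⟩
        linarith
      rw [zApply_zero (fun q hq => by rw [Amat_V hχ0 M hq, sub_self]) I p hV,
        zApply_zero (fun q hq => by
          rw [Ainv_one (fun a α => Amat_V hχ0 M hq a α), sub_self]) I p hV]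
      simp only [abs_zero, add_zero]
      positivity
  · intro M hM hMM p ht hx hle
    have hr : 0 < ‖p.2‖ := norm_pos_iff.2 hx
    suffices h : ∀ a α, Amat M χ p a α = kron a α from
      fun a α => ⟨h a α, Ainv_one h α a⟩
    intro a α
    rw [div_le_iff₀ (by linarith)] at hle
    rcases hle.lt_or_eq with hlt | heq
    · exact Amat_V hχ0 M ⟨by linarith, by linarith⟩ a α
    have hp : p ∈ Wset := ⟨by linarith, by linarith⟩
    have hBd : DifferentiableAt ℝ (BB χ a α) p :=
      diffAt ((Sy.BB (ι := Unit) hχ hχ1 a α 1).2.1 ()) hp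
    have hpath : Continuous (fun s : ℝ => ((p.1 + s, p.2) : Spt)) := by fun_prop
    have hp0 : ((p.1 + 0, p.2) : Spt) = p := by simp
    have hBc : Filter.Tendsto (fun s : ℝ => BB χ a α (p.1 + s, p.2)) (nhdsWithin 0 (Set.Ioi 0))
        (nhds (BB χ a α p)) := by
      have h1 := hpath.tendsto 0
      rw [hp0] at h1
      exact (hBd.continuousAt.tendsto.comp h1).mono_left nhdsWithin_le_nhds
    have hz : ∀ᶠ s in nhdsWithin (0:ℝ) (Set.Ioi 0), BB χ a α (p.1 + s, p.2) = 0 := by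
      have h1 := hpath.tendsto 0
      rw [hp0] at h1
      have h2 := nhdsWithin_le_nhds (s := Set.Ioi (0:ℝ)) (h1 (Wset_open.mem_nhds hp))
      filter_upwards [h2, self_mem_nhdsWithin] with s hs hs0
      have hs0' : 0 < s := hs0
      have hV : ((p.1 + s, p.2) : Spt) ∈ Vset := by
        refine ⟨?_, ?_⟩
        · show -1 < p.1 + s
          linarith
        · show ‖p.2‖ < (p.1 + s + 1) / 4
          linarith
      have h3 := Amat_V hχ0 M hV a α
      rw [Amat_W hχ hχ1 M hs] at h3
      have h4 : M * BB χ a α (p.1 + s, p.2) = 0 := by linarith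
      exact (mul_eq_zero.1 h4).resolve_left hM.ne'
    have h0 : BB χ a α p = 0 :=
      tendsto_nhds_unique (hBc.congr' hz) tendsto_const_nhds
    rw [Amat_W hχ hχ1 M hp, h0]
    ring
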